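/- Consider the following state-dependent finite MFG: T = 2, 𝕊 = {x̲, x̄}, 𝔸 = [a₀, 1−a₀] with 0 < a₀ < 1/2, q(0,x,μ,a;x̲) = q(0,x,μ,a;x̄) = 1/2, q(1,x,μ,a;x̲) = a, q(1,x,μ,a;x̄) = 1−a, F(0,x,μ,a) = 0, F(1,x,μ,a) = a(1−a), G(x,μ) = μ(x̲). Then for every μ ∈ 𝒫₀(𝕊): a control α* ∈ 𝒜_state is a state-dependent MFE at (0,μ) if and only if α*(1,x₁) ∈ {a₀, 1−a₀} for both x₁ ∈ 𝕊, and the raw set value consists exactly of three constant functions: V₀(0,μ) = { a₀(2−a₀), 1/2 + a₀ − a₀², 1 − a₀² }. -/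

import Mathlib

/-!
Statement 0 (Proposition 2.3, time consistency of state-dependent MFE).

Discrete-time finite-state mean field game.  Time set `𝕋 = {0,…,T}` (we use `ℕ` and
restrict attention to times `≤ T`), finite state space `S`, control set `A`.
Probability measures on `S` are encoded as functions `S → ℝ` satisfying `IsProb`.
-/

open Finset

namespace MFGSetValue

variable {S A : Type*} [Fintype S] [DecidableEq S]

/-- A probability vector on the finite state space `S`. -/
def IsProb (μ : S → ℝ) : Prop := (∀ x, 0 ≤ μ x) ∧ ∑ x, μ x = 1

/-- The measure flow `μ^α` determined by `ℙ^{t,μ,α}`: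
`μ^α_t = μ` and `μ^α_{s+1}(y) = ∑_x μ^α_s(x) q(s,x,μ^α_s,α(s,x);y)`.
(For `s < t` the value is irrelevant; we set it to `μ`.) -/
noncomputable def flow (q : ℕ → S → (S → ℝ) → A → S → ℝ) (α : ℕ → S → A)
    (t : ℕ) (μ : S → ℝ) : ℕ → S → ℝ
  | 0 => μ
  | s + 1 =>
    if s + 1 ≤ t then μ
    else fun y => ∑ x, flow q α t μ s x * q s x (flow q α t μ s) (α s x) y

/-- The law at each time of the Markov chain `ℙ^{{ν_·}; t, x₀, α̃}` started from `x₀`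
at time `t`, moving with transitions `q(s, ·, ν_s, α̃(s,·); ·)`. -/
noncomputable def chain (q : ℕ → S → (S → ℝ) → A → S → ℝ) (ν : ℕ → S → ℝ)
    (αt : ℕ → S → A) (t : ℕ) (x₀ : S) : ℕ → S → ℝ
  | 0 => fun x => if x = x₀ then 1 else 0
  | s + 1 =>
    if s + 1 ≤ t then fun x => if x = x₀ then 1 else 0
    else fun y => ∑ x, chain q ν αt t x₀ s x * q s x (ν s) (αt s x) y

/-- The cost `J(T₀, ψ; {ν_·}; t, x₀, α̃)` with horizon `T₀`, terminal reward `ψ(X_{T₀}, ν_{T₀})`,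
running cost `F`, against the measure flow `ν`:
`E[ψ(X_{T₀}, ν_{T₀}) + ∑_{s=t}^{T₀-1} F(s, X_s, ν_s, α̃(s,X_s))]`. -/
noncomputable def cost (q : ℕ → S → (S → ℝ) → A → S → ℝ)
    (F : ℕ → S → (S → ℝ) → A → ℝ) (T₀ : ℕ) (ψ : S → (S → ℝ) → ℝ)
    (ν : ℕ → S → ℝ) (t : ℕ) (x₀ : S) (αt : ℕ → S → A) : ℝ :=
  (∑ x, chain q ν αt t x₀ T₀ x * ψ x (ν T₀)) +
    ∑ s ∈ Finset.Ico t T₀, ∑ x, chain q ν αt t x₀ s x * F s x (ν s) (αt s x)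

/-- The value `v(T₀,ψ; {ν_·}; t, x₀) = inf_{α̃ ∈ 𝒜_state} J(T₀,ψ;{ν_·};t,x₀,α̃)`. -/
noncomputable def value (q : ℕ → S → (S → ℝ) → A → S → ℝ)
    (F : ℕ → S → (S → ℝ) → A → ℝ) (T₀ : ℕ) (ψ : S → (S → ℝ) → ℝ)
    (ν : ℕ → S → ℝ) (t : ℕ) (x₀ : S) : ℝ :=
  sInf { r : ℝ | ∃ αt : ℕ → S → A, r = cost q F T₀ ψ ν t x₀ αt }

/-- `α ∈ ℳ_state(T₀, ψ; t, μ)`: a state-dependent MFE for the game on `{t,…,T₀}` with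
terminal cost `ψ`.  (Taking `T₀ = T`, `ψ = G` gives `ℳ_state(t,μ)`.) -/
def isMFE (q : ℕ → S → (S → ℝ) → A → S → ℝ) (F : ℕ → S → (S → ℝ) → A → ℝ)
    (T₀ : ℕ) (ψ : S → (S → ℝ) → ℝ) (t : ℕ) (μ : S → ℝ) (α : ℕ → S → A) : Prop :=
  ∀ x, cost q F T₀ ψ (flow q α t μ) t x α = value q F T₀ ψ (flow q α t μ) t x

/-- Concatenation `α ⊕_{T₀} α'`. -/
def concat (T₀ : ℕ) (α α' : ℕ → S → A) : ℕ → S → A :=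
  fun s x => if s < T₀ then α s x else α' s x


/-- The raw set value `𝕍₀(t,μ)`. -/
noncomputable def rawSetValue (q : ℕ → S → (S → ℝ) → A → S → ℝ)
    (F : ℕ → S → (S → ℝ) → A → ℝ) (G : S → (S → ℝ) → ℝ)
    (T : ℕ) (t : ℕ) (μ : S → ℝ) : Set (S → ℝ) :=
  { φ | ∃ α : ℕ → S → A, isMFE q F T G t μ α ∧
      φ = fun x => cost q F T G (flow q α t μ) t x α }

end MFGSetValue

open MFGSetValue

theorem aux_cost (a₀ : ℝ)
    (ν : ℕ → Fin 2 → ℝ) (x : Fin 2)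
    (β : ℕ → Fin 2 → {a : ℝ // a ∈ Set.Icc a₀ (1 - a₀)}) :
    cost (fun s _ _ a y => if s = 0 then 1 / 2 else if y = 0 then a.1 else 1 - a.1)
      (fun s _ _ a => if s = 0 then 0 else a.1 * (1 - a.1)) 2 (fun _ μ => μ 0) ν 0 x β
      = ν 2 0 + ((β 1 0 : ℝ) * (1 - β 1 0) + (β 1 1 : ℝ) * (1 - β 1 1)) / 2 := by
  have hI : Finset.Ico 0 2 = {0, 1} := by decide
  fin_cases x <;> simp [cost, hI, chain, Fin.sum_univ_two] <;> ring

theorem aux_flow (a₀ : ℝ) (μ : Fin 2 → ℝ) (hμ : IsProb μ)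
    (β : ℕ → Fin 2 → {a : ℝ // a ∈ Set.Icc a₀ (1 - a₀)}) :
    flow (fun s _ _ a y => if s = 0 then 1 / 2 else if y = 0 then a.1 else 1 - a.1)
      β 0 μ 2 0 = ((β 1 0 : ℝ) + β 1 1) / 2 := by
  have h := hμ.2
  rw [Fin.sum_univ_two] at h
  have h1 : μ 1 = 1 - μ 0 := by linarith
  simp [flow, Fin.sum_univ_two, h1]
  ring

theorem aux_value (a₀ : ℝ) (ha₀' : a₀ < 1 / 2)
    (ν : ℕ → Fin 2 → ℝ) (x : Fin 2) :
    value (A := {a : ℝ // a ∈ Set.Icc a₀ (1 - a₀)})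
      (fun s _ _ a y => if s = 0 then 1 / 2 else if y = 0 then a.1 else 1 - a.1)
      (fun s _ _ a => if s = 0 then 0 else a.1 * (1 - a.1)) 2 (fun _ μ => μ 0) ν 0 x
      = ν 2 0 + a₀ * (1 - a₀) := by
  unfold value
  apply IsLeast.csInf_eq
  constructor
  · refine ⟨fun _ _ => ⟨a₀, le_refl _, by linarith⟩, ?_⟩
    rw [aux_cost]
    ring
  · rintro r ⟨β, rfl⟩
    rw [aux_cost]
    have h0 := (β 1 0).2
    have h1 := (β 1 1).2
    nlinarith [mul_nonneg (sub_nonneg.2 h0.1) (sub_nonneg.2 h0.2),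
      mul_nonneg (sub_nonneg.2 h1.1) (sub_nonneg.2 h1.2)]

theorem aux_mfe (a₀ : ℝ) (ha₀' : a₀ < 1 / 2) (μ : Fin 2 → ℝ)
    (α : ℕ → Fin 2 → {a : ℝ // a ∈ Set.Icc a₀ (1 - a₀)}) :
    isMFE (fun s _ _ a y => if s = 0 then 1 / 2 else if y = 0 then a.1 else 1 - a.1)
      (fun s _ _ a => if s = 0 then 0 else a.1 * (1 - a.1)) 2 (fun _ μ => μ 0) 0 μ α ↔
      ∀ x : Fin 2, ((α 1 x : ℝ) = a₀ ∨ (α 1 x : ℝ) = 1 - a₀) := by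
  unfold isMFE
  simp only [aux_cost, aux_value a₀ ha₀']
  constructor
  · intro h x
    have h := h 0
    have h0 := mul_nonneg (sub_nonneg.2 (α 1 0).2.1) (sub_nonneg.2 (α 1 0).2.2)
    have h1 := mul_nonneg (sub_nonneg.2 (α 1 1).2.1) (sub_nonneg.2 (α 1 1).2.2)
    have key : ((α 1 x : ℝ) - a₀) * (1 - a₀ - α 1 x) = 0 := by
      fin_cases x
      · show ((α 1 0 : ℝ) - a₀) * (1 - a₀ - α 1 0) = 0
        nlinarith
      · show ((α 1 1 : ℝ) - a₀) * (1 - a₀ - α 1 1) = 0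
        nlinarith
    rcases mul_eq_zero.1 key with h | h
    · left; linarith
    · right; linarith
  · intro h _
    rcases h 0 with h0 | h0 <;> rcases h 1 with h1 | h1 <;> rw [h0, h1] <;> ring

/-- Example 7.1.  The concrete state-dependent MFG with `T = 2`,
`𝕊 = {x̲, x̄} = Fin 2` (`x̲ = 0`), `𝔸 = [a₀, 1-a₀]`, `q(0,x,μ,a;·) ≡ 1/2`,
`q(1,x,μ,a;x̲) = a`, `F(0,·) = 0`, `F(1,x,μ,a) = a(1-a)`, `G(x,μ) = μ(x̲)`.
For every `μ ∈ 𝒫₀(𝕊)`: `α*` is a state-dependent MFE at `(0,μ)` iff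
`α*(1,x₁) ∈ {a₀, 1-a₀}` for every `x₁`, and
`𝕍₀(0,μ) = { a₀(2-a₀), 1/2 + a₀ - a₀², 1 - a₀² }` (three constant functions). -/
theorem example_three_raw_set_values
    (a₀ : ℝ) (ha₀ : 0 < a₀) (ha₀' : a₀ < 1 / 2)
    (q : ℕ → Fin 2 → (Fin 2 → ℝ) → {a : ℝ // a ∈ Set.Icc a₀ (1 - a₀)} → Fin 2 → ℝ)
    (F : ℕ → Fin 2 → (Fin 2 → ℝ) → {a : ℝ // a ∈ Set.Icc a₀ (1 - a₀)} → ℝ)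
    (G : Fin 2 → (Fin 2 → ℝ) → ℝ)
    (hq : q = fun s _ _ a y => if s = 0 then 1 / 2 else if y = 0 then a.1 else 1 - a.1)
    (hF : F = fun s _ _ a => if s = 0 then 0 else a.1 * (1 - a.1))
    (hG : G = fun _ μ => μ 0)
    (μ : Fin 2 → ℝ) (hμ : IsProb μ) (hμfull : ∀ x, 0 < μ x) :
    (∀ α : ℕ → Fin 2 → {a : ℝ // a ∈ Set.Icc a₀ (1 - a₀)},
      isMFE q F 2 G 0 μ α ↔ ∀ x : Fin 2, ((α 1 x : ℝ) = a₀ ∨ (α 1 x : ℝ) = 1 - a₀)) ∧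
    rawSetValue q F G 2 0 μ =
      {(fun _ => a₀ * (2 - a₀)), (fun _ => 1 / 2 + a₀ - a₀ ^ 2),
        (fun _ => 1 - a₀ ^ 2)} := by
  subst hq hF hG
  refine ⟨fun α => aux_mfe a₀ ha₀' μ α, ?_⟩
  ext φ
  simp only [rawSetValue, aux_mfe a₀ ha₀', aux_cost, aux_flow a₀ μ hμ, Set.mem_setOf_eq,
    Set.mem_insert_iff, Set.mem_singleton_iff]
  constructor
  · rintro ⟨α, h, rfl⟩
    rcases h 0 with h0 | h0 <;> rcases h 1 with h1 | h1 <;> rw [h0, h1]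
    · left; funext _; ring
    · right; left; funext _; ring
    · right; left; funext _; ring
    · right; right; funext _; ring
  · rintro (rfl | rfl | rfl)
    · refine ⟨fun _ _ => ⟨a₀, le_refl _, by linarith⟩, fun _ => Or.inl rfl, ?_⟩
      funext _; ring
    · refine ⟨fun _ x => if x = 0 then ⟨a₀, le_refl _, by linarith⟩
        else ⟨1 - a₀, by linarith, le_refl _⟩, fun x => ?_, ?_⟩
      · fin_cases x <;> simp
      · funext _
        simp
        ring
    · refine ⟨fun _ _ => ⟨1 - a₀, by linarith, le_refl _⟩, fun _ => Or.inr rfl, ?_⟩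
      funext _; ring
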